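/- arXiv:1901.04723 — 3 statements merged into one kernel-verified Lean document; each statement's English description precedes it below -/
import Mathlib

section
/- Let (Ω, F, μ) be a probability space, let R ≥ 0 be a constant, and let w, w̄, r : Ω → ℝ be random variables such that w̄ ≤ w μ-almost everywhere, E_μ[w] = 1, 0 ≤ r ≤ R μ-almost everywhere, and w̄, w·r and w̄·r are all integrable. Then 0 ≤ E_μ[(w − w̄)·r] ≤ E_μ[1 − w̄] · R. (In particular the sub-optimality incurred by replacing the importance weight w by any lower-bound surrogate w̄ is controlled by the expected self-normalization gap E_μ[1 − w̄].) -/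
open MeasureTheory

/-- **Probability gap (Theorem: Gap).** For any lower-bound surrogate `w̄ ≤ w` of an
importance weight `w` with `E_μ[w] = 1`, and rewards `0 ≤ r ≤ R`, the sub-optimality
`E_μ[(w − w̄)·r]` is nonnegative and bounded by the expected self-normalization gap
`E_μ[1 − w̄]` times `R`. -/
theorem gap_bound {Ω : Type*} [MeasurableSpace Ω] (μ : Measure Ω) [IsProbabilityMeasure μ]
    (R : ℝ) (hR : 0 ≤ R) (w wbar r : Ω → ℝ)
    (hle : ∀ᵐ ω ∂μ, wbar ω ≤ w ω)
    (hEw : ∫ ω, w ω ∂μ = 1)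
    (hr0 : ∀ᵐ ω ∂μ, 0 ≤ r ω) (hrR : ∀ᵐ ω ∂μ, r ω ≤ R)
    (hwbar_int : Integrable wbar μ)
    (hwr_int : Integrable (fun ω => w ω * r ω) μ)
    (hwbarr_int : Integrable (fun ω => wbar ω * r ω) μ) :
    0 ≤ ∫ ω, (w ω - wbar ω) * r ω ∂μ ∧
      ∫ ω, (w ω - wbar ω) * r ω ∂μ ≤ (∫ ω, (1 - wbar ω) ∂μ) * R := by
  have hw : Integrable w μ := by
    by_contra h
    rw [integral_undef h] at hEw
    exact zero_ne_one hEw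
  have hint : Integrable (fun ω => (w ω - wbar ω) * r ω) μ := by
    have h := hwr_int.sub hwbarr_int
    refine h.congr (Filter.Eventually.of_forall fun ω => ?_)
    simp only [Pi.sub_apply]
    ring
  constructor
  · apply integral_nonneg_of_ae
    filter_upwards [hle, hr0] with ω h1 h2
    exact mul_nonneg (sub_nonneg.2 h1) h2
  · have h1 : ∫ ω, (1 - wbar ω) ∂μ = ∫ ω, (w ω - wbar ω) ∂μ := by
      rw [integral_sub (integrable_const _) hwbar_int, integral_sub hw hwbar_int, hEw]
      simp
    rw [h1, ← integral_mul_const]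
    apply integral_mono_ae hint ((hw.sub hwbar_int).mul_const R)
    filter_upwards [hle, hrR] with ω h2 h3
    exact mul_le_mul_of_nonneg_left h3 (sub_nonneg.2 h2)
end

section
/- Let X and A be finite nonempty types, let p : X → ℝ be a probability mass function on contexts (p x ≥ 0 for all x and ∑_x p x = 1), let μ and π be policies (maps assigning to each context x a probability mass function over actions with strictly positive entries: μ x a > 0, π x a > 0 for all a, and ∑_a μ x a = ∑_a π x a = 1), and let r : X → A → ℝ be a nonnegative reward function. Then the policy improvement is bounded below by the reward-weighted log-likelihood-ratio objective: ∑_x p x · (∑_a π x a · r x a) − ∑_x p x · (∑_a μ x a · r x a) ≥ ∑_x p x · ∑_a μ x a · r x a · log(π x a / μ x a). -/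
/-- **Policy improvement lower bound (first inequality of the statistical learning bound).**
For a context distribution `p`, strictly positive policies `μ, π`, and nonnegative rewards
`r`, the policy improvement `E_π r − E_μ r` is bounded below by the reward-weighted
log-likelihood-ratio objective `E_μ[r·log(π/μ)]`. -/
theorem policy_improvement_lower_bound {X A : Type*}
    [Fintype X] [Fintype A] [Nonempty X] [Nonempty A]
    (p : X → ℝ) (hp : ∀ x, 0 ≤ p x) (hp1 : ∑ x, p x = 1)
    (μ π : X → A → ℝ)
    (hμpos : ∀ x a, 0 < μ x a) (hπpos : ∀ x a, 0 < π x a)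
    (hμsum : ∀ x, ∑ a, μ x a = 1) (hπsum : ∀ x, ∑ a, π x a = 1)
    (r : X → A → ℝ) (hr : ∀ x a, 0 ≤ r x a) :
    ∑ x, p x * (∑ a, π x a * r x a) - ∑ x, p x * (∑ a, μ x a * r x a) ≥
      ∑ x, p x * ∑ a, μ x a * r x a * Real.log (π x a / μ x a) := by
  rw [ge_iff_le, ← Finset.sum_sub_distrib]
  refine Finset.sum_le_sum fun x _ => ?_
  rw [← mul_sub, ← Finset.sum_sub_distrib]
  refine mul_le_mul_of_nonneg_left (Finset.sum_le_sum fun a _ => ?_) (hp x)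
  have hm := hμpos x a
  have h := Real.log_le_sub_one_of_pos (div_pos (hπpos x a) hm)
  calc μ x a * r x a * Real.log (π x a / μ x a)
      ≤ μ x a * r x a * (π x a / μ x a - 1) :=
        mul_le_mul_of_nonneg_left h (mul_nonneg hm.le (hr x a))
    _ = π x a * r x a - μ x a * r x a := by
        field_simp
end

section
/- Let X₁, X₂, A be finite nonempty types, let p : X₁ × X₂ → ℝ be a probability mass function (p ≥ 0, ∑ p = 1), let μ assign to each pair (x₁, x₂) a probability mass function over A with μ(a|x₁,x₂) > 0 for all a, define the marginal p₁(x₁) := ∑_{x₂} p(x₁,x₂) and the marginalized policy π̂(a|x₁) := (∑_{x₂} p(x₁,x₂)·μ(a|x₁,x₂)) / p₁(x₁) for p₁(x₁) > 0. Then the minimal expected Kullback-Leibler divergence ∑_{x₁,x₂} p(x₁,x₂) ∑_a μ(a|x₁,x₂) log(μ(a|x₁,x₂)/π̂(a|x₁)) equals the conditional mutual information I(A; X₂ | X₁) of the joint law q(x₁,x₂,a) := p(x₁,x₂)·μ(a|x₁,x₂), namely ∑_{x₁ : p₁(x₁)>0} ∑_{x₂, a} q(x₁,x₂,a) · log( (p₁(x₁)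 · q(x₁,x₂,a)) / (p(x₁,x₂) · ∑_{x₂'} q(x₁,x₂',a)) ), and this quantity is nonnegative. Consequently, for every policy π depending only on x₁ (with positive entries), ∑_{x₁,x₂} p(x₁,x₂) ∑_a μ(a|x₁,x₂) log(μ(a|x₁,x₂)/π(a|x₁)) ≥ I(A; X₂ | X₁) ≥ 0. -/
open Finset

/-- The conditional mutual information `I(A; X₂ | X₁)` of the joint law
`q(x₁,x₂,a) := p(x₁,x₂)·μ(a|x₁,x₂)`, written as
`∑_{x₁ : p₁(x₁)>0} ∑_{x₂,a} q · log( (p₁(x₁)·q(x₁,x₂,a)) / (p(x₁,x₂)·∑_{x₂'} q(x₁,x₂',a)) )`. -/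
noncomputable def condMutualInfo {X₁ X₂ A : Type*} [Fintype X₁] [Fintype X₂] [Fintype A]
    (p : X₁ × X₂ → ℝ) (μ : X₁ × X₂ → A → ℝ) : ℝ :=
  ∑ x₁ ∈ Finset.univ.filter (fun x₁ => 0 < ∑ x₂, p (x₁, x₂)), ∑ x₂, ∑ a,
    (p (x₁, x₂) * μ (x₁, x₂) a) *
      Real.log ((∑ x₂', p (x₁, x₂')) * (p (x₁, x₂) * μ (x₁, x₂) a) /
        (p (x₁, x₂) * ∑ x₂', p (x₁, x₂') * μ (x₁, x₂') a))

/-- Gibbs' inequality. -/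
theorem gibbs_aux {A : Type*} [Fintype A] (f g : A → ℝ) (hf : ∀ a, 0 < f a)
    (hg : ∀ a, 0 < g a) (hfs : ∑ a, f a = 1) (hgs : ∑ a, g a = 1) :
    0 ≤ ∑ a, f a * Real.log (f a / g a) := by
  have h : ∑ a, (f a - g a) ≤ ∑ a, f a * Real.log (f a / g a) := by
    apply Finset.sum_le_sum
    intro a _
    have h1 := Real.log_le_sub_one_of_pos (div_pos (hg a) (hf a))
    have h2 : Real.log (f a / g a) = - Real.log (g a / f a) := by
      rw [← Real.log_inv, inv_div]
    have h3 := mul_le_mul_of_nonneg_left h1 (hf a).le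
    have h4 : f a * (g a / f a - 1) = g a - f a := by
      have := (hf a).ne'
      field_simp
    rw [h2]
    linarith
  rw [Finset.sum_sub_distrib, hfs, hgs] at h
  linarith

/-- **IML diagnosis.** The minimal expected KL divergence, attained by the marginalized
policy `π̂(a|x₁) = (∑_{x₂} p(x₁,x₂)·μ(a|x₁,x₂)) / p₁(x₁)`, equals the conditional mutual
information `I(A; X₂ | X₁)` of the joint law `q(x₁,x₂,a) = p(x₁,x₂)·μ(a|x₁,x₂)`, which
is nonnegative; consequently the expected KL divergence of every policy depending only
on `x₁` is at least `I(A; X₂ | X₁) ≥ 0`. -/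
theorem iml_diagnosis {X₁ X₂ A : Type*}
    [Fintype X₁] [Fintype X₂] [Fintype A] [Nonempty X₁] [Nonempty X₂] [Nonempty A]
    (p : X₁ × X₂ → ℝ) (hp : ∀ x, 0 ≤ p x) (hp1 : ∑ x, p x = 1)
    (μ : X₁ × X₂ → A → ℝ)
    (hμpos : ∀ x a, 0 < μ x a) (hμsum : ∀ x, ∑ a, μ x a = 1) :
    (∑ x₁, ∑ x₂, p (x₁, x₂) * ∑ a, μ (x₁, x₂) a *
        Real.log (μ (x₁, x₂) a /
          ((∑ x₂', p (x₁, x₂') * μ (x₁, x₂') a) / (∑ x₂', p (x₁, x₂'))))) =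
      condMutualInfo p μ ∧
    0 ≤ condMutualInfo p μ ∧
    ∀ π : X₁ → A → ℝ, (∀ x₁ a, 0 < π x₁ a) → (∀ x₁, ∑ a, π x₁ a = 1) →
      ∑ x₁, ∑ x₂, p (x₁, x₂) * ∑ a, μ (x₁, x₂) a * Real.log (μ (x₁, x₂) a / π x₁ a) ≥
        condMutualInfo p μ := by
  have hz : ∀ x₁, ¬ 0 < ∑ x₂, p (x₁, x₂) → ∀ x₂, p (x₁, x₂) = 0 := by
    intro x₁ h x₂
    have h0 : ∑ x₂, p (x₁, x₂) = 0 :=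
      le_antisymm (not_lt.mp h) (Finset.sum_nonneg fun _ _ => hp _)
    exact (Finset.sum_eq_zero_iff_of_nonneg (fun _ _ => hp _)).mp h0 x₂ (Finset.mem_univ _)
  have hq : ∀ x₁, 0 < ∑ x₂, p (x₁, x₂) → ∀ a, 0 < ∑ x₂, p (x₁, x₂) * μ (x₁, x₂) a := by
    intro x₁ h a
    obtain ⟨x₂, -, h2⟩ := (Finset.sum_pos_iff_of_nonneg (fun _ _ => hp _)).mp h
    exact Finset.sum_pos' (fun _ _ => mul_nonneg (hp _) (hμpos _ _).le)
      ⟨x₂, Finset.mem_univ _, mul_pos h2 (hμpos _ _)⟩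
  have hs : ∀ x₁, ∑ a, ∑ x₂, p (x₁, x₂) * μ (x₁, x₂) a = ∑ x₂, p (x₁, x₂) := by
    intro x₁
    rw [Finset.sum_comm]
    simp [← Finset.mul_sum, hμsum]
  have hhat : ∀ x₁, 0 < ∑ x₂, p (x₁, x₂) →
      ∑ a, (∑ x₂, p (x₁, x₂) * μ (x₁, x₂) a) / (∑ x₂, p (x₁, x₂)) = 1 := by
    intro x₁ h
    rw [← Finset.sum_div, hs, div_self h.ne']
  have heq : (∑ x₁, ∑ x₂, p (x₁, x₂) * ∑ a, μ (x₁, x₂) a *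
        Real.log (μ (x₁, x₂) a /
          ((∑ x₂', p (x₁, x₂') * μ (x₁, x₂') a) / (∑ x₂', p (x₁, x₂'))))) =
      condMutualInfo p μ := by
    unfold condMutualInfo
    rw [Finset.sum_filter]
    refine Finset.sum_congr rfl fun x₁ _ => ?_
    split_ifs with h
    · refine Finset.sum_congr rfl fun x₂ _ => ?_
      rw [Finset.mul_sum]
      refine Finset.sum_congr rfl fun a _ => ?_
      by_cases h0 : p (x₁, x₂) = 0
      · simp [h0]
      · have := (hq x₁ h a).ne'
        have := h.ne'
        rw [mul_assoc]
        congr 3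
        rw [mul_left_comm, mul_div_mul_left _ _ h0, div_div_eq_mul_div, mul_comm]
    · exact Finset.sum_eq_zero fun x₂ _ => by rw [hz x₁ h x₂, zero_mul]
  refine ⟨heq, ?_, ?_⟩
  · rw [← heq]
    refine Finset.sum_nonneg fun x₁ _ => Finset.sum_nonneg fun x₂ _ => ?_
    by_cases h : 0 < ∑ x₂, p (x₁, x₂)
    · exact mul_nonneg (hp _) (gibbs_aux _ _ (hμpos _) (fun a => div_pos (hq x₁ h a) h)
        (hμsum _) (hhat x₁ h))
    · rw [hz x₁ h x₂, zero_mul]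
  · intro π hπ hπs
    rw [← heq, ge_iff_le]
    refine Finset.sum_le_sum fun x₁ _ => ?_
    by_cases h : 0 < ∑ x₂, p (x₁, x₂)
    · have hg := gibbs_aux _ _ (fun a => div_pos (hq x₁ h a) h) (hπ x₁) (hhat x₁ h) (hπs x₁)
      have hg2 := mul_nonneg h.le hg
      rw [← sub_nonneg, ← Finset.sum_sub_distrib]
      convert hg2 using 1
      set P := ∑ x₂, p (x₁, x₂) with hP
      have e : ∀ a, P * ((∑ x₂, p (x₁, x₂) * μ (x₁, x₂) a) / P *
          Real.log ((∑ x₂, p (x₁, x₂) * μ (x₁, x₂) a) / P / π x₁ a)) =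
          ∑ x₂, p (x₁, x₂) * μ (x₁, x₂) a *
          Real.log ((∑ x₂, p (x₁, x₂) * μ (x₁, x₂) a) / P / π x₁ a) := by
        intro a
        rw [← Finset.sum_mul, ← mul_assoc, mul_div_cancel₀ _ h.ne']
      rw [Finset.mul_sum, Finset.sum_congr rfl (fun a _ => e a), Finset.sum_comm]
      refine Finset.sum_congr rfl fun x₂ _ => ?_
      rw [← mul_sub, ← Finset.sum_sub_distrib, Finset.mul_sum]
      refine Finset.sum_congr rfl fun a _ => ?_
      have hh := (div_pos (hq x₁ h a) h).ne'
      rw [Real.log_div (hμpos _ _).ne' (hπ _ _).ne', Real.log_div (hμpos _ _).ne' hh,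
        Real.log_div hh (hπ _ _).ne']
      ring
    · refine le_of_eq (Finset.sum_congr rfl fun x₂ _ => ?_)
      rw [hz x₁ h x₂, zero_mul, zero_mul]
end
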